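/- arXiv:2004.07929 — 6 statements merged into one kernel-verified Lean document; each statement's English description precedes it below -/
import Mathlib

section
/- Let e ∈ ℝ³ be a unit vector (‖e‖ = 1) and let θ : ℝ → ℝ be differentiable with θ(t)/4 ∈ (−π/2, π/2) for all t. Define σ(t) = tan(θ(t)/4) • e, and suppose ω : ℝ → ℝ³ is such that the kinematic equation σ′(t) = M(σ(t)) ·ᵥ ω(t) holds for all t, where M(x) = (1/4)·((1 − ‖x‖²)·I₃ + 2·x^× + 2·x xᵀ). Then θ′(t) = ⟨e, ω(t)⟩ for all t. -/
open Real Matrix RealInnerProductSpace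

noncomputable section

/-- The cross-product (skew-symmetric) matrix `x^×` of `x ∈ ℝ³`. -/
def skewMat (x : EuclideanSpace ℝ (Fin 3)) : Matrix (Fin 3) (Fin 3) ℝ :=
  !![0, -x 2, x 1; x 2, 0, -x 0; -x 1, x 0, 0]

/-- The MRP kinematics matrix `M(x) = (1/4)((1-‖x‖²) I₃ + 2 x^× + 2 x xᵀ)`. -/
def Mmat (x : EuclideanSpace ℝ (Fin 3)) : Matrix (Fin 3) (Fin 3) ℝ :=
  (1/4 : ℝ) • ((1 - ‖x‖^2) • (1 : Matrix (Fin 3) (Fin 3) ℝ)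
    + (2:ℝ) • skewMat x + (2:ℝ) • Matrix.vecMulVec x x)

/-- Matrix-vector multiplication on Euclidean space. -/
def mulVecE (A : Matrix (Fin 3) (Fin 3) ℝ) (v : EuclideanSpace ℝ (Fin 3)) :
    EuclideanSpace ℝ (Fin 3) :=
  (EuclideanSpace.equiv (Fin 3) ℝ).symm (A *ᵥ (EuclideanSpace.equiv (Fin 3) ℝ v))

/-- If `e` is a unit vector, the component of `M(s e) w` along `e` is `(1 + s²)/4` times that
of `w`. -/
theorem inner_mulVecE_Mmat_smul {e : EuclideanSpace ℝ (Fin 3)} (he : ‖e‖ = 1) (s : ℝ)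
    (w : EuclideanSpace ℝ (Fin 3)) :
    ⟪e, mulVecE (Mmat (s • e)) w⟫ = (1 + s ^ 2) / 4 * ⟪e, w⟫ := by
  have hsum : e 0 ^ 2 + e 1 ^ 2 + e 2 ^ 2 = 1 := by
    have h := EuclideanSpace.real_norm_sq_eq e
    rw [he, Fin.sum_univ_three] at h
    linarith
  have hnorm : ‖s • e‖ ^ 2 = s ^ 2 := by
    rw [norm_smul, he, mul_one, Real.norm_eq_abs, sq_abs]
  simp only [mulVecE, Mmat, hnorm, skewMat]
  simp [PiLp.inner_apply, Fin.sum_univ_three, Matrix.mulVec, dotProduct, Matrix.vecMulVec_apply]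
  linear_combination
    (s ^ 2 / 2 * (e 0 * w 0 + e 1 * w 1 + e 2 * w 2)) * hsum

/-- Lemma 1: along the MRP kinematics `σ' = M(σ) ω` with `σ = tan(θ/4) e`,
the principal rotation angle satisfies `θ' = ⟨e, ω⟩`. -/
theorem rotation_angle_derivative
    (e : EuclideanSpace ℝ (Fin 3)) (he : ‖e‖ = 1)
    (θ : ℝ → ℝ) (hθdiff : Differentiable ℝ θ)
    (hθrange : ∀ t : ℝ, θ t / 4 ∈ Set.Ioo (-(π/2)) (π/2))
    (σ : ℝ → EuclideanSpace ℝ (Fin 3))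
    (hσ : ∀ t : ℝ, σ t = Real.tan (θ t / 4) • e)
    (ω : ℝ → EuclideanSpace ℝ (Fin 3))
    (hkin : ∀ t : ℝ, deriv σ t = mulVecE (Mmat (σ t)) (ω t)) :
    ∀ t : ℝ, deriv θ t = ⟪e, ω t⟫ := by
  intro t
  have hcos : cos (θ t / 4) ≠ 0 := (cos_pos_of_mem_Ioo (hθrange t)).ne'
  have htan : HasDerivAt (fun u => tan (θ u / 4))
      (1 / cos (θ t / 4) ^ 2 * (deriv θ t / 4)) t :=
    HasDerivAt.comp (h₂ := tan) t (hasDerivAt_tan hcos) ((hθdiff t).hasDerivAt.div_const 4)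
  have hderiv : deriv σ t = (1 / cos (θ t / 4) ^ 2 * (deriv θ t / 4)) • e := by
    rw [funext hσ]
    exact (htan.smul_const e).deriv
  have hinner := congrArg (fun v => ⟪e, v⟫) (hderiv.symm.trans (hkin t))
  simp only [hσ t, inner_mulVecE_Mmat_smul he, real_inner_smul_right,
    real_inner_self_eq_norm_sq, he] at hinner
  have hsec : 1 + tan (θ t / 4) ^ 2 = 1 / cos (θ t / 4) ^ 2 := by
    rw [one_div, ← inv_one_add_tan_sq hcos, inv_inv]
  rw [hsec] at hinner
  field_simp at hinner
  linarith
end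
end

section
/- Let α > 0 and define f : ℝ → ℝ by f(θ) = sinh((θ − π)/4) · sin(θ/4) · cos(θ/4). Let θ : ℝ → ℝ be differentiable with θ′(t) = α · f(θ(t)) for all t ≥ 0 and θ(0) ∈ (0, π). Then for all t ≥ 0 one has θ(t) ∈ (0, θ(0)], the function t ↦ θ(t) is monotone nonincreasing on [0, ∞), and θ(t) → 0 as t → ∞. -/
open Real Filter

/-- A trajectory that crosses the exponential `θ 0 * exp (-β t)` only with a smaller slope stays
below it. -/
theorem le_mul_exp_of_deriv_lt {θ : ℝ → ℝ} (hθ : Differentiable ℝ θ) {β : ℝ}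
    (h : ∀ t ≥ (0:ℝ), θ t = θ 0 * exp (-β * t) → deriv θ t < -β * θ t)
    {t : ℝ} (ht : 0 ≤ t) : θ t ≤ θ 0 * exp (-β * t) := by
  have hB : ∀ x, HasDerivAt (fun s => θ 0 * exp (-β * s)) (-β * (θ 0 * exp (-β * x))) x := by
    intro x
    have h1 : HasDerivAt (fun s : ℝ => -β * s) (-β) x := by
      simpa using (hasDerivAt_id x).const_mul (-β)
    exact (h1.exp.const_mul (θ 0)).congr_deriv (by ring)
  refine image_le_of_deriv_right_lt_deriv_boundary (a := 0) (b := t) (f' := deriv θ)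
    hθ.continuous.continuousOn (fun x _ => (hθ x).hasDerivAt.hasDerivWithinAt)
    (by simp) hB (fun x hx hxe => ?_) ⟨ht, le_rfl⟩
  have := h x hx.1 hxe
  rwa [hxe] at this

/-- A trajectory that crosses the exponential `θ 0 * exp (-β t)` only with a larger slope stays
above it. -/
theorem mul_exp_le_of_lt_deriv {θ : ℝ → ℝ} (hθ : Differentiable ℝ θ) {β : ℝ}
    (h : ∀ t ≥ (0:ℝ), θ t = θ 0 * exp (-β * t) → -β * θ t < deriv θ t)
    {t : ℝ} (ht : 0 ≤ t) : θ 0 * exp (-β * t) ≤ θ t := by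
  have key := le_mul_exp_of_deriv_lt (θ := fun s => -θ s) (β := β) hθ.neg (fun s hs hse => by
    have h1 := h s hs (by linarith)
    have h2 : deriv (fun s => -θ s) s = -deriv θ s := (hθ s).hasDerivAt.neg.deriv
    rw [h2]
    linarith) ht
  linarith

/-- If the vector field `g` satisfies `-C x ≤ g x ≤ -c x` on `(0, θ 0]` with `c > 0`, then the
trajectory of `θ' = g θ` stays in `(0, θ 0]`, decreases, and converges to `0`. -/
theorem antitoneOn_and_tendsto_zero_of_linear_bounds {θ g : ℝ → ℝ} (hθ : Differentiable ℝ θ)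
    (hode : ∀ t ≥ (0:ℝ), deriv θ t = g (θ t)) (h0 : 0 < θ 0) {c C : ℝ} (hc : 0 < c)
    (hlower : ∀ x ∈ Set.Ioc 0 (θ 0), -C * x ≤ g x)
    (hupper : ∀ x ∈ Set.Ioc 0 (θ 0), g x ≤ -c * x) :
    (∀ t ≥ (0:ℝ), θ t ∈ Set.Ioc 0 (θ 0)) ∧
    AntitoneOn θ (Set.Ici 0) ∧
    Tendsto θ atTop (nhds 0) := by
  have hC : 0 < C + 1 := by
    have h1 := hlower (θ 0) ⟨h0, le_rfl⟩
    have h2 := hupper (θ 0) ⟨h0, le_rfl⟩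
    have : c ≤ C := le_of_mul_le_mul_right (by linarith) h0
    linarith
  have hmem : ∀ β > (0:ℝ), ∀ t ≥ (0:ℝ), θ 0 * exp (-β * t) ∈ Set.Ioc 0 (θ 0) := by
    intro β hβ t ht
    refine ⟨by positivity, mul_le_of_le_one_right h0.le (exp_le_one_iff.2 ?_)⟩
    nlinarith [mul_nonneg hβ.le ht]
  have hge : ∀ t ≥ (0:ℝ), θ 0 * exp (-(C + 1) * t) ≤ θ t := fun t ht =>
    mul_exp_le_of_lt_deriv hθ (fun s hs hse => by
      have hm := hmem _ hC s hs
      rw [← hse] at hm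
      rw [hode s hs]
      linarith [hlower _ hm, hm.1]) ht
  have hle : ∀ t ≥ (0:ℝ), θ t ≤ θ 0 * exp (-(c / 2) * t) := fun t ht =>
    le_mul_exp_of_deriv_lt hθ (fun s hs hse => by
      have hm := hmem _ (half_pos hc) s hs
      rw [← hse] at hm
      rw [hode s hs]
      nlinarith [hupper _ hm, mul_pos hc hm.1]) ht
  have hθmem : ∀ t ≥ (0:ℝ), θ t ∈ Set.Ioc 0 (θ 0) := fun t ht =>
    ⟨(hmem _ hC t ht).1.trans_le (hge t ht), (hle t ht).trans (hmem _ (half_pos hc) t ht).2⟩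
  refine ⟨hθmem, ?_, ?_⟩
  · refine antitoneOn_of_deriv_nonpos (convex_Ici 0) hθ.continuous.continuousOn
      hθ.differentiableOn (fun t ht => ?_)
    have ht : (0:ℝ) ≤ t := interior_subset ht
    have hm := hθmem t ht
    rw [hode t ht]
    nlinarith [hupper _ hm, mul_pos hc hm.1]
  · have hlin : Tendsto (fun t : ℝ => -(c / 2) * t) atTop atBot :=
      tendsto_id.const_mul_atTop_of_neg (by linarith)
    have hlim : Tendsto (fun t : ℝ => θ 0 * exp (-(c / 2) * t)) atTop (nhds 0) := by
      simpa using (tendsto_exp_atBot.comp hlin).const_mul (θ 0)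
    refine tendsto_of_tendsto_of_tendsto_of_le_of_le' tendsto_const_nhds hlim ?_ ?_
    · filter_upwards [eventually_ge_atTop 0] with t ht using (hθmem t ht).1.le
    · filter_upwards [eventually_ge_atTop 0] with t ht using hle t ht

/-- The sliding-surface vector field in terms of the half angle. -/
theorem sinh_mul_sin_mul_cos_eq (x : ℝ) :
    sinh ((x - π) / 4) * sin (x / 4) * cos (x / 4) = -(sinh ((π - x) / 4) * sin (x / 2) / 2) := by
  have h1 : sinh ((x - π) / 4) = -sinh ((π - x) / 4) := by
    rw [← sinh_neg]
    ring_nf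
  have h2 : sin (x / 2) = 2 * sin (x / 4) * cos (x / 4) := by
    rw [← sin_two_mul]
    ring_nf
  rw [h1, h2]
  ring

/-- Theorem 1, case `θ(0) ∈ (0, π)`: along the reduced sliding-surface dynamics
`θ' = α sinh((θ−π)/4) sin(θ/4) cos(θ/4)`, the rotation angle stays in `(0, θ(0)]`,
decreases monotonically, and converges to `0` (no unwinding). -/
theorem unwinding_free_on_sliding_surface_to_zero
    (α : ℝ) (hα : 0 < α) (θ : ℝ → ℝ) (hθ : Differentiable ℝ θ)
    (hode : ∀ t ≥ (0:ℝ), deriv θ t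
      = α * (Real.sinh ((θ t - π)/4) * Real.sin (θ t / 4) * Real.cos (θ t / 4)))
    (h0 : θ 0 ∈ Set.Ioo (0:ℝ) π) :
    (∀ t ≥ (0:ℝ), θ t ∈ Set.Ioc 0 (θ 0)) ∧
    AntitoneOn θ (Set.Ici 0) ∧
    Tendsto θ atTop (nhds 0) := by
  obtain ⟨hpos, hlt⟩ := h0
  have hs : 0 < sinh ((π - θ 0) / 4) := sinh_pos_iff.2 (by linarith)
  refine antitoneOn_and_tendsto_zero_of_linear_bounds
    (g := fun x => α * (sinh ((x - π) / 4) * sin (x / 4) * cos (x / 4)))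
    (c := α * (sinh ((π - θ 0) / 4) * (1 / π) / 2)) (C := α * (sinh (π / 4) * (1 / 2) / 2))
    hθ hode hpos (by positivity) ?_ ?_
  · rintro x ⟨hx0, hx1⟩
    have hsin : sin (x / 2) ≤ x / 2 := sin_le (by linarith)
    have hsin0 : 0 ≤ sin (x / 2) := sin_nonneg_of_nonneg_of_le_pi (by linarith) (by linarith)
    have hsinh : sinh ((π - x) / 4) ≤ sinh (π / 4) := sinh_le_sinh.2 (by linarith)
    have hmul : sinh ((π - x) / 4) * sin (x / 2) ≤ sinh (π / 4) * (x / 2) :=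
      mul_le_mul hsinh hsin hsin0 (sinh_nonneg_iff.2 (by positivity))
    simp only [sinh_mul_sin_mul_cos_eq]
    linarith [mul_le_mul_of_nonneg_left hmul hα.le]
  · rintro x ⟨hx0, hx1⟩
    have hsin : 2 / π * (x / 2) ≤ sin (x / 2) := mul_le_sin (by linarith) (by linarith)
    have hsinh : sinh ((π - θ 0) / 4) ≤ sinh ((π - x) / 4) := sinh_le_sinh.2 (by linarith)
    have hmul : sinh ((π - θ 0) / 4) * (2 / π * (x / 2)) ≤ sinh ((π - x) / 4) * sin (x / 2) :=
      mul_le_mul hsinh hsin (by positivity) (hs.le.trans hsinh)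
    simp only [sinh_mul_sin_mul_cos_eq]
    have hα_mul := mul_le_mul_of_nonneg_left hmul hα.le
    ring_nf at hα_mul ⊢
    linarith
end

section
/- Let α > 0 and define f : ℝ → ℝ by f(θ) = sinh((θ − π)/4) · sin(θ/4) · cos(θ/4). Let θ : ℝ → ℝ be differentiable with θ′(t) = α · f(θ(t)) for all t ≥ 0 and θ(0) ∈ (π, 2π). Then for all t ≥ 0 one has θ(t) ∈ [θ(0), 2π), the function t ↦ θ(t) is monotone nondecreasing on [0, ∞), and θ(t) → 2π as t → ∞. -/
open Real Filter

section ScalarODE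

open Set

variable {g y : ℝ → ℝ} {b : ℝ}

/-- A solution of a scalar autonomous ODE starting below an equilibrium stays below it. -/
lemma lt_equilibrium_of_deriv_eq (hg : ContDiff ℝ 1 g) (hgb : g b = 0)
    (hy : Differentiable ℝ y) (hode : ∀ t ≥ 0, deriv y t = g (y t)) (h0 : y 0 < b) :
    ∀ t ≥ 0, y t < b := by
  intro t ht
  by_contra! hbt
  obtain ⟨c, hc, hyc⟩ := intermediate_value_Icc ht hy.continuous.continuousOn ⟨h0.le, hbt⟩
  have hK : IsCompact (insert b (y '' Icc 0 c)) :=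
    (isCompact_Icc.image hy.continuous).insert b
  obtain ⟨K, hKg⟩ :=
    hg.locallyLipschitz.locallyLipschitzOn.exists_lipschitzOnWith_of_compact hK
  have heq : EqOn y (fun _ ↦ b) (Icc 0 c) :=
    ODE_solution_unique_of_mem_Icc_left (v := fun _ ↦ g) (fun _ _ ↦ hKg)
      hy.continuous.continuousOn
      (fun s hs ↦ by
        simpa [hode s hs.1.le] using (hy s).hasDerivAt.hasDerivWithinAt (s := Iic s))
      (fun s hs ↦ mem_insert_of_mem _ (mem_image_of_mem y (Ioc_subset_Icc_self hs)))
      continuousOn_const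
      (fun s _ ↦ by simpa [hgb] using hasDerivWithinAt_const s (Iic s) b)
      (fun _ _ ↦ mem_insert _ _) hyc
  exact h0.ne (heq ⟨le_rfl, hc.1⟩)

/-- A solution of a scalar autonomous ODE stays above its initial value if the vector field is
positive there. -/
lemma initial_le_of_deriv_eq (hg0 : 0 < g (y 0))
    (hy : Differentiable ℝ y) (hode : ∀ t ≥ 0, deriv y t = g (y t)) :
    ∀ t ≥ 0, y 0 ≤ y t := by
  intro t ht
  refine image_le_of_deriv_right_lt_deriv_boundary' (f := fun _ ↦ y 0) (f' := fun _ ↦ 0)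
    (B' := fun s ↦ g (y s)) continuousOn_const (fun s _ ↦ hasDerivWithinAt_const s _ _) le_rfl
    hy.continuous.continuousOn (fun s hs ↦ ?_) (fun s _ h ↦ ?_) ⟨ht, le_rfl⟩
  · simpa [hode s hs.1] using (hy s).hasDerivAt.hasDerivWithinAt (s := Ici s)
  · simpa [← h] using hg0

/-- A solution of a scalar autonomous ODE whose vector field is positive between the initial value
and the next equilibrium increases to that equilibrium without reaching it. -/
theorem mem_Ico_and_monotoneOn_and_tendsto_of_deriv_eq (hg : ContDiff ℝ 1 g) (hgb : g b = 0)
    (hy : Differentiable ℝ y) (hode : ∀ t ≥ 0, deriv y t = g (y t)) (h0 : y 0 < b)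
    (hpos : ∀ x ∈ Ico (y 0) b, 0 < g x) :
    (∀ t ≥ 0, y t ∈ Ico (y 0) b) ∧ MonotoneOn y (Ici 0) ∧ Tendsto y atTop (nhds b) := by
  have hmem : ∀ t ≥ 0, y t ∈ Ico (y 0) b := fun t ht ↦
    ⟨initial_le_of_deriv_eq (hpos _ ⟨le_rfl, h0⟩) hy hode t ht,
      lt_equilibrium_of_deriv_eq hg hgb hy hode h0 t ht⟩
  have hmono : MonotoneOn y (Ici 0) := by
    refine monotoneOn_of_deriv_nonneg (convex_Ici 0) hy.continuous.continuousOn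
      hy.differentiableOn fun t ht ↦ ?_
    have ht : 0 ≤ t := interior_subset ht
    exact hode t ht ▸ (hpos _ (hmem t ht)).le
  refine ⟨hmem, hmono, tendsto_order.2 ⟨fun e he ↦ ?_, fun e he ↦ ?_⟩⟩
  · suffices ∃ t ≥ 0, e < y t by
      obtain ⟨t, ht, het⟩ := this
      filter_upwards [eventually_ge_atTop t] with s hs
      exact het.trans_le (hmono ht (ht.trans hs) hs)
    by_contra! hle
    obtain ⟨m, hm, hmin⟩ := isCompact_Icc.exists_isMinOn
      (nonempty_Icc.2 (hle 0 le_rfl)) hg.continuous.continuousOn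
    have hgm : 0 < g m := hpos m ⟨hm.1, hm.2.trans_lt he⟩
    have hgrow := (convex_Ici (0 : ℝ)).mul_sub_le_image_sub_of_le_deriv
      hy.continuous.continuousOn hy.differentiableOn (C := g m) fun t ht ↦ by
        have ht : 0 ≤ t := interior_subset ht
        exact hode t ht ▸ hmin ⟨(hmem t ht).1, hle t ht⟩
    have hT : 0 ≤ (b - y 0) / g m := div_nonneg (sub_nonneg.2 h0.le) hgm.le
    have := hgrow 0 self_mem_Ici _ hT hT
    rw [sub_zero, mul_div_cancel₀ _ hgm.ne'] at this
    linarith [(hmem _ hT).2]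
  · filter_upwards [eventually_ge_atTop 0] with t ht
    exact (hmem t ht).2.trans he

end ScalarODE

/-- Theorem 1, case `θ(0) ∈ (π, 2π)`: along the reduced sliding-surface dynamics
`θ' = α sinh((θ−π)/4) sin(θ/4) cos(θ/4)`, the rotation angle stays in `[θ(0), 2π)`,
increases monotonically, and converges to `2π` (no unwinding). -/
theorem unwinding_free_on_sliding_surface_to_two_pi
    (α : ℝ) (hα : 0 < α) (θ : ℝ → ℝ) (hθ : Differentiable ℝ θ)
    (hode : ∀ t ≥ (0:ℝ), deriv θ t
      = α * (Real.sinh ((θ t - π)/4) * Real.sin (θ t / 4) * Real.cos (θ t / 4)))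
    (h0 : θ 0 ∈ Set.Ioo π (2*π)) :
    (∀ t ≥ (0:ℝ), θ t ∈ Set.Ico (θ 0) (2*π)) ∧
    MonotoneOn θ (Set.Ici 0) ∧
    Tendsto θ atTop (nhds (2*π)) := by
  refine mem_Ico_and_monotoneOn_and_tendsto_of_deriv_eq
    (g := fun x ↦ α * (Real.sinh ((x - π)/4) * Real.sin (x / 4) * Real.cos (x / 4)))
    (by fun_prop) ?_ hθ hode h0.2 fun x hx ↦ ?_
  · have : 2 * π / 4 = π / 2 := by ring
    simp [this]
  · have hπx : π < x := h0.1.trans_le hx.1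
    have hx2 : x < 2 * π := hx.2
    have hsinh : 0 < Real.sinh ((x - π) / 4) := Real.sinh_pos_iff.2 (by linarith)
    have hsin : 0 < Real.sin (x / 4) :=
      Real.sin_pos_of_pos_of_lt_pi (by linarith [pi_pos]) (by linarith)
    have hcos : 0 < Real.cos (x / 4) :=
      Real.cos_pos_of_mem_Ioo ⟨by linarith [pi_pos], by linarith⟩
    positivity
end

section
/- Let α > 0, let f(θ) = sinh((θ − π)/4) · sin(θ/4) · cos(θ/4), and let θ : ℝ → ℝ be differentiable with θ(t) ∈ [0, 2π] and θ′(t) = α · f(θ(t)) for all t. Define V₁(t) = cosh(π/4) − cosh((θ(t) − π)/4). Then V₁ is differentiable and V₁′(t) = −(α/4) · sinh²((θ(t) − π)/4) · sin(θ(t)/4) · cos(θ(t)/4), and consequently V₁′(t) ≤ 0 for all t. -/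
open Real

/-- Equation (34): along the reduced dynamics `θ' = α sinh((θ−π)/4) sin(θ/4) cos(θ/4)`
with `θ(t) ∈ [0, 2π]`, the Lyapunov function `V₁ = cosh(π/4) − cosh((θ−π)/4)` is
differentiable with `V₁' = −(α/4) sinh²((θ−π)/4) sin(θ/4) cos(θ/4) ≤ 0`. -/
theorem lyapunov_V1_derivative
    (α : ℝ) (hα : 0 < α) (θ : ℝ → ℝ) (hθ : Differentiable ℝ θ)
    (hrange : ∀ t : ℝ, θ t ∈ Set.Icc (0:ℝ) (2*π))
    (hode : ∀ t : ℝ, deriv θ t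
      = α * (Real.sinh ((θ t - π)/4) * Real.sin (θ t / 4) * Real.cos (θ t / 4)))
    (V₁ : ℝ → ℝ)
    (hV₁ : ∀ t : ℝ, V₁ t = Real.cosh (π/4) - Real.cosh ((θ t - π)/4)) :
    Differentiable ℝ V₁ ∧
    (∀ t : ℝ, deriv V₁ t
      = -(α/4) * (Real.sinh ((θ t - π)/4))^2 * Real.sin (θ t / 4) * Real.cos (θ t / 4)) ∧
    (∀ t : ℝ, deriv V₁ t ≤ 0) := by
  have hderiv : ∀ t : ℝ, HasDerivAt V₁
      (-(α/4) * (Real.sinh ((θ t - π)/4))^2 * Real.sin (θ t / 4) * Real.cos (θ t / 4)) t := by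
    intro t
    rw [funext hV₁]
    have h := ((((hθ t).hasDerivAt.sub_const π).div_const 4).cosh).const_sub (Real.cosh (π/4))
    refine h.congr_deriv ?_
    rw [hode t]
    ring
  refine ⟨fun t => (hderiv t).differentiableAt, fun t => (hderiv t).deriv, fun t => ?_⟩
  rw [(hderiv t).deriv]
  obtain ⟨h0, h1⟩ := hrange t
  have hsin : 0 ≤ Real.sin (θ t / 4) :=
    Real.sin_nonneg_of_nonneg_of_le_pi (by linarith) (by linarith [Real.pi_pos])
  have hcos : 0 ≤ Real.cos (θ t / 4) :=
    Real.cos_nonneg_of_neg_pi_div_two_le_of_le (by linarith [Real.pi_pos]) (by linarith)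
  have hprod : 0 ≤ (α/4) * (Real.sinh ((θ t - π)/4))^2 * Real.sin (θ t / 4)
      * Real.cos (θ t / 4) := by positivity
  linarith
end

section
/- Let λ > 0 and a ∈ (0, 1). Let V : ℝ → ℝ be differentiable with V(t) ≥ 0 for all t ≥ 0 and V′(t) ≤ −λ · (V(t))^a for all t ≥ 0. Then V(t) = 0 for all t ≥ V(0)^{1−a} / (λ · (1 − a)). -/
open Real

/-- A function that stays positive on `[0, t]` and satisfies `V' ≤ -l V^a` there obeys the
integrated decay estimate for `V^(1-a)`. -/
theorem rpow_one_sub_add_le_of_deriv_le {l a t : ℝ} (ha : a < 1) (ht : 0 ≤ t) {V : ℝ → ℝ}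
    (hV : Differentiable ℝ V) (hpos : ∀ s ∈ Set.Icc 0 t, 0 < V s)
    (hineq : ∀ s ∈ Set.Icc 0 t, deriv V s ≤ -l * V s ^ a) :
    V t ^ (1 - a) + l * (1 - a) * t ≤ V 0 ^ (1 - a) := by
  have hderiv : ∀ s ∈ Set.Icc 0 t, HasDerivAt (fun s => V s ^ (1 - a) + l * (1 - a) * s)
      (deriv V s * (1 - a) * V s ^ (1 - a - 1) + l * (1 - a) * 1) s := fun s hs =>
    ((hV s).hasDerivAt.rpow_const (Or.inl (hpos s hs).ne')).add
      ((hasDerivAt_id s).const_mul (l * (1 - a)))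
  have hanti : AntitoneOn (fun s => V s ^ (1 - a) + l * (1 - a) * s) (Set.Icc 0 t) := by
    refine antitoneOn_of_deriv_nonpos (convex_Icc 0 t)
      (fun s hs => (hderiv s hs).continuousAt.continuousWithinAt)
      (fun s hs => (hderiv s (interior_subset hs)).differentiableAt.differentiableWithinAt)
      fun s hs => ?_
    have hs := interior_subset hs
    rw [(hderiv s hs).deriv]
    have hmul : V s ^ a * V s ^ (1 - a - 1) = 1 := by
      rw [← Real.rpow_add (hpos s hs)]
      simp
    have hc : 0 ≤ (1 - a) * V s ^ (1 - a - 1) :=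
      mul_nonneg (by linarith) (Real.rpow_nonneg (hpos s hs).le _)
    calc deriv V s * (1 - a) * V s ^ (1 - a - 1) + l * (1 - a) * 1
        = deriv V s * ((1 - a) * V s ^ (1 - a - 1)) + l * (1 - a) := by ring
      _ ≤ -l * V s ^ a * ((1 - a) * V s ^ (1 - a - 1)) + l * (1 - a) := by
        gcongr
        exact hineq s hs
      _ = 0 := by linear_combination -l * (1 - a) * hmul
  simpa using hanti (Set.left_mem_Icc.2 ht) (Set.right_mem_Icc.2 ht) ht

/-- Lemma 2 (finite-time stability): if `V ≥ 0` is differentiable and satisfies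
`V' ≤ −λ V^a` for `t ≥ 0` with `λ > 0` and `a ∈ (0,1)`, then `V` vanishes for all
`t ≥ V(0)^(1−a)/(λ(1−a))`. -/
theorem finite_time_stability
    (l a : ℝ) (hl : 0 < l) (ha : a ∈ Set.Ioo (0:ℝ) 1)
    (V : ℝ → ℝ) (hV : Differentiable ℝ V)
    (hnonneg : ∀ t ≥ (0:ℝ), 0 ≤ V t)
    (hineq : ∀ t ≥ (0:ℝ), deriv V t ≤ -l * (V t) ^ a) :
    ∀ t : ℝ, (V 0) ^ (1 - a) / (l * (1 - a)) ≤ t → V t = 0 := by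
  intro t ht
  have hc : 0 < l * (1 - a) := mul_pos hl (by linarith [ha.2])
  have ht0 : 0 ≤ t :=
    (div_nonneg (Real.rpow_nonneg (hnonneg 0 le_rfl) _) hc.le).trans ht
  have hanti : AntitoneOn V (Set.Ici 0) := by
    refine antitoneOn_of_deriv_nonpos (convex_Ici 0) hV.continuous.continuousOn
      hV.differentiableOn fun s hs => ?_
    have hs : 0 ≤ s := interior_subset hs
    have := mul_nonneg hl.le (Real.rpow_nonneg (hnonneg s hs) a)
    linarith [hineq s hs]
  by_contra hne
  have hVt : 0 < V t := (hnonneg t ht0).lt_of_ne' hne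
  have hle := rpow_one_sub_add_le_of_deriv_le ha.2 ht0 hV
    (fun s hs => hVt.trans_le (hanti hs.1 ht0 hs.2)) fun s hs => hineq s hs.1
  have hpow := Real.rpow_pos_of_pos hVt (1 - a)
  rw [div_le_iff₀ hc] at ht
  linarith
end

section
/- Let J be a 3×3 diagonal matrix with positive diagonal entries J₁, J₂, J₃, let s, d ∈ ℝ³, let γ₁ ≥ ‖d‖ and γ₂ ≥ 0, and let sgn(s) ∈ ℝ³ denote the componentwise sign vector of s (with sign(0) = 0). Then ⟨s, J⁻¹ ·ᵥ (−(γ₁ + γ₂) • sgn(s) + d)⟩ ≤ −γ₂ · (min{1/J₁, 1/J₂, 1/J₃}) · ‖s‖. -/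
open Real Matrix RealInnerProductSpace

noncomputable section

theorem mul_sign_feedback_le {m a x y γ₁ γ₂ : ℝ} (hm : 0 ≤ m) (hma : m ≤ a)
    (hy : |y| ≤ γ₁) (hγ₂ : 0 ≤ γ₂) :
    x * (a * (-(γ₁ + γ₂) * Real.sign x + y)) ≤ -γ₂ * m * |x| := by
  have hx : x * Real.sign x = |x| := by
    rcases lt_trichotomy x 0 with h | rfl | h
    · rw [Real.sign_of_neg h, abs_of_neg h, mul_neg_one]
    · simp
    · rw [Real.sign_of_pos h, abs_of_pos h, mul_one]
  have hxy : x * y ≤ γ₁ * |x| := calc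
    x * y ≤ |x| * |y| := (le_abs_self _).trans_eq (abs_mul x y)
    _ ≤ γ₁ * |x| := by rw [mul_comm]; gcongr
  calc x * (a * (-(γ₁ + γ₂) * Real.sign x + y))
      = a * (-(γ₁ + γ₂) * (x * Real.sign x) + x * y) := by ring
    _ ≤ a * (-γ₂ * |x|) := by
      rw [hx]
      exact mul_le_mul_of_nonneg_left (by linarith) (hm.trans hma)
    _ ≤ -γ₂ * m * |x| := by
      have := mul_le_mul_of_nonneg_right hma (mul_nonneg hγ₂ (abs_nonneg x))
      linarith

theorem EuclideanSpace.norm_le_sum_abs {ι : Type*} [Fintype ι] (s : EuclideanSpace ℝ ι) :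
    ‖s‖ ≤ ∑ i, |s i| := by
  rw [EuclideanSpace.norm_eq]
  refine Real.sqrt_le_iff.2 ⟨Finset.sum_nonneg fun i _ => abs_nonneg _, ?_⟩
  exact Finset.sum_sq_le_sq_sum_of_nonneg fun i _ => abs_nonneg (s i)

theorem mulVecE_inv_diagonal_apply {v : Fin 3 → ℝ} (hv : ∀ i, v i ≠ 0)
    (x : EuclideanSpace ℝ (Fin 3)) (i : Fin 3) :
    mulVecE (Matrix.diagonal v)⁻¹ x i = 1 / v i * x i := by
  have h : (Matrix.diagonal v)⁻¹ = Matrix.diagonal fun i => 1 / v i := by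
    refine Matrix.inv_eq_right_inv ?_
    rw [Matrix.diagonal_mul_diagonal, ← Matrix.diagonal_one]
    congr 1
    ext j
    exact mul_one_div_cancel (hv j)
  rw [h]
  exact Matrix.mulVec_diagonal _ (EuclideanSpace.equiv (Fin 3) ℝ x) i

/-- The central estimate (46)–(48) in the proof of Theorem 2(i): with a positive
diagonal inertia matrix `J`, disturbance `‖d‖ ≤ γ₁`, and gain `γ₂ ≥ 0`,
`sᵀ J⁻¹ (−(γ₁+γ₂) sgn(s) + d) ≤ −γ₂ λ_min(J⁻¹) ‖s‖`. -/
theorem sliding_mode_reaching_estimate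
    (J1 J2 J3 : ℝ) (hJ1 : 0 < J1) (hJ2 : 0 < J2) (hJ3 : 0 < J3)
    (γ1 γ2 : ℝ) (s d : EuclideanSpace ℝ (Fin 3))
    (hγ1 : ‖d‖ ≤ γ1) (hγ2 : 0 ≤ γ2)
    (sgn : EuclideanSpace ℝ (Fin 3)) (hsgn : ∀ i : Fin 3, sgn i = Real.sign (s i)) :
    ⟪s, mulVecE (Matrix.diagonal ![J1, J2, J3])⁻¹ (-(γ1 + γ2) • sgn + d)⟫
      ≤ -γ2 * min (1/J1) (min (1/J2) (1/J3)) * ‖s‖ := by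
  set m := min (1/J1) (min (1/J2) (1/J3)) with hm_def
  have hm : 0 ≤ m := by positivity
  have hv : ∀ i, ![J1, J2, J3] i ≠ 0 := by
    intro i
    fin_cases i <;> simp [hJ1.ne', hJ2.ne', hJ3.ne']
  have hmv : ∀ i, m ≤ 1 / ![J1, J2, J3] i := by
    intro i
    fin_cases i <;> simp [hm_def]
  have hd : ∀ i, |d i| ≤ γ1 := fun i => (PiLp.norm_apply_le d i).trans hγ1
  calc ⟪s, mulVecE (Matrix.diagonal ![J1, J2, J3])⁻¹ (-(γ1 + γ2) • sgn + d)⟫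
      = ∑ i, s i * (1 / ![J1, J2, J3] i * (-(γ1 + γ2) * Real.sign (s i) + d i)) := by
        rw [PiLp.inner_apply]
        refine Finset.sum_congr rfl fun i _ => ?_
        rw [mulVecE_inv_diagonal_apply hv, PiLp.add_apply, PiLp.smul_apply, hsgn,
          smul_eq_mul, real_inner_eq_re_inner, RCLike.inner_apply', conj_trivial, RCLike.re_to_real]
    _ ≤ ∑ i, -γ2 * m * |s i| :=
        Finset.sum_le_sum fun i _ => mul_sign_feedback_le hm (hmv i) (hd i) hγ2
    _ = -γ2 * m * ∑ i, |s i| := (Finset.mul_sum _ _ _).symm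
    _ ≤ -γ2 * m * ‖s‖ :=
        mul_le_mul_of_nonpos_left (EuclideanSpace.norm_le_sum_abs s)
          (mul_nonpos_of_nonpos_of_nonneg (neg_nonpos.2 hγ2) hm)
end
end
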